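/- arXiv:2309.06674 — 2 statements merged into one kernel-verified Lean document; each statement's English description precedes it below -/
import Mathlib

section
/- Let σ² > 0, and let ℓ, Γ, T, I, s be real numbers with ℓ ≤ Γ, I ≥ 0, T − s ≥ Γσ², and s ≥ ℓ·I. Define Γ̂ = (Γσ² + ℓ·I)/(σ² + I). Then: (i) T ≥ Γ̂·(σ² + I), i.e., T − Γ̂·I ≥ Γ̂σ² (the original bilinear SINR constraint holds at Γ̂); and (ii) ℓ ≤ Γ̂ ≤ Γ. -/
/-- Construction of a feasible SINR value from a McCormick-relaxation solution. -/
theorem stmt_8 (σ2 ℓ Γ T I s : ℝ) (hσ : 0 < σ2) (hℓΓ : ℓ ≤ Γ) (hI : 0 ≤ I)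
    (hTs : T - s ≥ Γ * σ2) (hsl : s ≥ ℓ * I) :
    T ≥ (Γ * σ2 + ℓ * I) / (σ2 + I) * (σ2 + I) ∧
    T - (Γ * σ2 + ℓ * I) / (σ2 + I) * I ≥ (Γ * σ2 + ℓ * I) / (σ2 + I) * σ2 ∧
    ℓ ≤ (Γ * σ2 + ℓ * I) / (σ2 + I) ∧ (Γ * σ2 + ℓ * I) / (σ2 + I) ≤ Γ := by
  have hpos : 0 < σ2 + I := by linarith
  have hmul : (Γ * σ2 + ℓ * I) / (σ2 + I) * (σ2 + I) = Γ * σ2 + ℓ * I :=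
    div_mul_cancel₀ _ hpos.ne'
  refine ⟨by linarith, by linarith, ?_, ?_⟩
  · rw [le_div_iff₀ hpos]
    linarith [mul_le_mul_of_nonneg_right hℓΓ hσ.le]
  · rw [div_le_iff₀ hpos]
    linarith [mul_le_mul_of_nonneg_right hℓΓ hI]
end

section
/- Fix K ≥ 1, positive reals P_T, σ², ρ, and vectors h₁,…,h_K ∈ ℂ^{N_t}. Consider the feasible set F of tuples (R, (Γ_k)_{k=1}^K, (W_k)_{k=1}^K), where R and each W_k are N_t×N_t complex matrices and each Γ_k ≥ 0, satisfying: tr(R) ≤ P_T; R − Σ_{k=1}^K W_k positive semidefinite; each W_k positive semidefinite; and for each k, h_kᴴ W_k h_k − Γ_k · h_kᴴ(R − W_k) h_k ≥ Γ_k σ². Suppose (R̄, (Γ̄_k), (W̄_k)) ∈ F with h_kᴴ W̄_k h_k ≠ 0 for all k, and define W̃_k = (W̄_k h_k h_kᴴ W̄_k)/(h_kᴴ W̄_k h_k). Then (R̄, (Γ̄_k), (W̃_k)) ∈ F and rank(W̃_k) = 1 for every k. -/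
open Matrix
open scoped ComplexOrder

/-- Feasibility of the joint beamforming SDR problem. -/
def Feas {K Nt : ℕ} (PT σ2 : ℝ) (h : Fin K → Fin Nt → ℂ)
    (R : Matrix (Fin Nt) (Fin Nt) ℂ) (Γ : Fin K → ℝ)
    (W : Fin K → Matrix (Fin Nt) (Fin Nt) ℂ) : Prop :=
  (∀ k, 0 ≤ Γ k) ∧ R.trace.re ≤ PT ∧ (R - ∑ k, W k).PosSemidef ∧
    (∀ k, (W k).PosSemidef) ∧
    ∀ k, (star (h k) ⬝ᵥ (W k) *ᵥ h k).re
        - Γ k * (star (h k) ⬝ᵥ (R - W k) *ᵥ h k).re ≥ Γ k * σ2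

section RankOneCompression

variable {n : Type*} [Fintype n]

theorem vecMulVec_star_mul_mul_vecMulVec_star (A : Matrix n n ℂ) (x : n → ℂ) :
    vecMulVec x (star x) * A * vecMulVec x (star x) =
      (star x ⬝ᵥ A *ᵥ x) • vecMulVec x (star x) := by
  rw [vecMulVec_mul, vecMulVec_mul_vecMulVec, ← dotProduct_mulVec, vecMulVec_smul]

theorem Matrix.IsHermitian.mul_vecMulVec_star_mul {A : Matrix n n ℂ} (hA : A.IsHermitian)
    (x : n → ℂ) :
    A * vecMulVec x (star x) * A = vecMulVec (A *ᵥ x) (star (A *ᵥ x)) := by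
  rw [mul_vecMulVec, vecMulVec_mul, star_mulVec, hA.eq]

/-- The compression `A x xᴴ A / (xᴴ A x)` of a positive semidefinite matrix is positive
semidefinite. -/
theorem Matrix.PosSemidef.rankOneCompression {A : Matrix n n ℂ} (hA : A.PosSemidef)
    (x : n → ℂ) :
    ((star x ⬝ᵥ A *ᵥ x)⁻¹ • (A * vecMulVec x (star x) * A)).PosSemidef := by
  rw [hA.isHermitian.mul_vecMulVec_star_mul]
  exact (posSemidef_vecMulVec_self_star _).smul
    (inv_nonneg_of_nonneg (hA.dotProduct_mulVec_nonneg x))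

/-- A positive semidefinite matrix dominates its compression `A x xᴴ A / (xᴴ A x)`. -/
theorem Matrix.PosSemidef.sub_rankOneCompression {A : Matrix n n ℂ} (hA : A.PosSemidef)
    {x : n → ℂ} (hx : star x ⬝ᵥ A *ᵥ x ≠ 0) :
    (A - (star x ⬝ᵥ A *ᵥ x)⁻¹ • (A * vecMulVec x (star x) * A)).PosSemidef := by
  classical
  have hQ := vecMulVec_star_mul_mul_vecMulVec_star A x
  have hc : star (star x ⬝ᵥ A *ᵥ x) = star x ⬝ᵥ A *ᵥ x :=
    (IsSelfAdjoint.of_nonneg (hA.dotProduct_mulVec_nonneg x)).star_eq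
  set c := star x ⬝ᵥ A *ᵥ x
  set Q := vecMulVec x (star x) with hQdef
  have hQH : Qᴴ = Q := by rw [hQdef, conjTranspose_vecMulVec, star_star]
  have key := hA.conjTranspose_mul_mul_same (1 - c⁻¹ • (Q * A))
  have hAQA : A * Q * A * Q * A = c • (A * Q * A) := by
    rw [show A * Q * A * Q * A = A * (Q * A * Q) * A by simp only [mul_assoc], hQ]
    simp only [Matrix.mul_smul, Matrix.smul_mul]
  convert key using 1
  rw [conjTranspose_sub, conjTranspose_one, conjTranspose_smul, conjTranspose_mul, hQH,
    hA.isHermitian.eq, star_inv₀, hc]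
  simp only [sub_mul, mul_sub, one_mul, mul_one, Matrix.mul_smul, Matrix.smul_mul, ← mul_assoc,
    hAQA, smul_smul, inv_mul_cancel₀ hx]
  simp

/-- The compression `A x xᴴ A / (xᴴ A x)` has the same quadratic form as `A` at `x`. -/
theorem dotProduct_rankOneCompression_mulVec {A : Matrix n n ℂ} {x : n → ℂ}
    (hx : star x ⬝ᵥ A *ᵥ x ≠ 0) :
    star x ⬝ᵥ ((star x ⬝ᵥ A *ᵥ x)⁻¹ • (A * vecMulVec x (star x) * A)) *ᵥ x =
      star x ⬝ᵥ A *ᵥ x := by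
  rw [mul_vecMulVec, vecMulVec_mul, smul_mulVec, vecMulVec_mulVec, ← dotProduct_mulVec]
  simp only [dotProduct_smul, smul_eq_mul, op_smul_eq_smul]
  field_simp

theorem Matrix.IsHermitian.rank_rankOneCompression {A : Matrix n n ℂ} (hA : A.IsHermitian)
    {x : n → ℂ} (hx : star x ⬝ᵥ A *ᵥ x ≠ 0) :
    ((star x ⬝ᵥ A *ᵥ x)⁻¹ • (A * vecMulVec x (star x) * A)).rank = 1 := by
  have hAx : A *ᵥ x ≠ 0 := fun h0 => hx (by rw [h0, dotProduct_zero])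
  rw [hA.mul_vecMulVec_star_mul, ← smul_vecMulVec]
  refine le_antisymm (rank_vecMulVec_le _ _) (Nat.one_le_iff_ne_zero.mpr fun h0 => ?_)
  classical
  rw [rank_eq_finrank_range_toLin _ (Pi.basisFun ℂ n) (Pi.basisFun ℂ n),
    Submodule.finrank_eq_zero, LinearMap.range_eq_bot, LinearEquiv.map_eq_zero_iff] at h0
  exact vecMulVec_ne_zero (smul_ne_zero (inv_ne_zero hx) hAx) (star_ne_zero.mpr hAx) h0

end RankOneCompression

/-- The rank-one replacement `W̃_k = (W̄_k h_k h_kᴴ W̄_k)/(h_kᴴ W̄_k h_k)`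
preserves feasibility of the SDR problem, and each `W̃_k` has rank one. -/
theorem stmt_13 (K Nt : ℕ) (hK : 1 ≤ K) (PT σ2 ρ : ℝ)
    (hPT : 0 < PT) (hσ : 0 < σ2) (hρ : 0 < ρ)
    (h : Fin K → Fin Nt → ℂ)
    (R : Matrix (Fin Nt) (Fin Nt) ℂ) (Γ : Fin K → ℝ)
    (W : Fin K → Matrix (Fin Nt) (Fin Nt) ℂ)
    (hfeas : Feas PT σ2 h R Γ W)
    (hne : ∀ k, star (h k) ⬝ᵥ (W k) *ᵥ h k ≠ 0) :
    Feas PT σ2 h R Γ (fun k =>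
        (star (h k) ⬝ᵥ (W k) *ᵥ h k)⁻¹ •
          (W k * vecMulVec (h k) (star (h k)) * W k)) ∧
    ∀ k, ((star (h k) ⬝ᵥ (W k) *ᵥ h k)⁻¹ •
        (W k * vecMulVec (h k) (star (h k)) * W k)).rank = 1 := by
  obtain ⟨hΓ, htr, hR, hW, hsinr⟩ := hfeas
  refine ⟨⟨hΓ, htr, ?_, fun k => (hW k).rankOneCompression (h k), fun k => ?_⟩,
    fun k => (hW k).isHermitian.rank_rankOneCompression (hne k)⟩
  · have hsum := posSemidef_sum Finset.univ
      fun k _ => (hW k).sub_rankOneCompression (hne k)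
    rw [Finset.sum_sub_distrib] at hsum
    simpa only [sub_add_sub_cancel] using hR.add hsum
  · have hk := hsinr k
    rw [sub_mulVec, dotProduct_sub] at hk ⊢
    rwa [dotProduct_rankOneCompression_mulVec (hne k)]
end
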